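/- Let A ∈ ℂ^{n×n} and let P be Hermitian with A P + P A* = W for some positive definite Hermitian W. Then P is nonsingular, and P and A have the same inertia: the number of eigenvalues of P that are positive equals the number of eigenvalues of A with positive real part, and likewise for negative. -/

import Mathlib

open Matrix
open scoped ComplexOrder

/-- The pair `(B, P)` can be simultaneously brought to a form from which both inertias are read. -/
def Good15 {ι : Type} [Fintype ι] [DecidableEq ι] (B P : Matrix ι ι ℂ) : Prop :=
  ∃ (S S' : Matrix ι ι ℂ) (d : ι → ℝ) (μ : ι → ℂ), S * S' = 1 ∧ S' * S = 1 ∧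
    Sᴴ * P * S = diagonal (fun i => (d i : ℂ)) ∧
    B.charpoly = ∏ i, (Polynomial.X - Polynomial.C (μ i)) ∧ ∀ i, 0 < d i * (μ i).re

lemma good15_conj {ι : Type} [Fintype ι] [DecidableEq ι] {B P T T' : Matrix ι ι ℂ}
    (h1 : T * T' = 1) (h2 : T' * T = 1) (h : Good15 (T' * B * T) (Tᴴ * P * T)) : Good15 B P := by
  obtain ⟨S, S', d, μ, hS, hS', hP, hB, hd⟩ := h
  refine ⟨T * S, S' * T', d, μ, ?_, ?_, ?_, ?_, hd⟩
  · calc T * S * (S' * T') = T * (S * S') * T' := by simp only [Matrix.mul_assoc]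
      _ = 1 := by rw [hS, Matrix.mul_one, h1]
  · calc S' * T' * (T * S) = S' * (T' * T) * S := by simp only [Matrix.mul_assoc]
      _ = 1 := by rw [h2, Matrix.mul_one, hS']
  · rw [← hP, conjTranspose_mul]; simp only [Matrix.mul_assoc]
  · rw [← hB]
    have := charpoly_units_conj' (⟨T, T', h1, h2⟩ : (Matrix ι ι ℂ)ˣ) B
    have hi : T⁻¹ = T' := inv_eq_right_inv h1
    simpa only [Units.val_mk, Units.inv_mk, hi] using this.symm

lemma posDef15_conj {ι : Type} [Fintype ι] [DecidableEq ι] {B P T T' : Matrix ι ι ℂ}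
    (h1 : T * T' = 1) (h2 : T' * T = 1) (h : (P * B + Bᴴ * P).PosDef) :
    ((Tᴴ * P * T) * (T' * B * T) + (T' * B * T)ᴴ * (Tᴴ * P * T)).PosDef := by
  have h3 : T'ᴴ * Tᴴ = 1 := by rw [← conjTranspose_mul, h1, conjTranspose_one]
  have h4 : Tᴴ * T'ᴴ = 1 := by rw [← conjTranspose_mul, h2, conjTranspose_one]
  have := h.conjTranspose_mul_mul_same (B := T) (by
    intro x y hxy
    have := congrArg (T' *ᵥ ·) hxy
    simpa [mulVec_mulVec, h2] using this)
  convert this using 1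
  have e1 : (Tᴴ * P * T) * (T' * B * T) = Tᴴ * P * (T * T') * B * T := by
    simp only [Matrix.mul_assoc]
  have e2 : (T' * B * T)ᴴ * (Tᴴ * P * T) = Tᴴ * Bᴴ * (T'ᴴ * Tᴴ) * P * T := by
    simp only [conjTranspose_mul, Matrix.mul_assoc]
  rw [e1, e2, h1, h3]
  simp only [Matrix.mul_one, Matrix.mul_add, Matrix.add_mul, Matrix.mul_assoc]

lemma good15_block {κ : Type} [Fintype κ] [DecidableEq κ] {B P : Matrix κ κ ℂ}
    (b : Matrix Unit κ ℂ) (d : ℝ) (l : ℂ) (hd : 0 < d * l.re) (h : Good15 B P) :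
    Good15 (fromBlocks (diagonal fun _ => l) b 0 B)
      (fromBlocks (diagonal fun _ : Unit => (d : ℂ)) 0 0 P) := by
  obtain ⟨S, S', d', μ, hS, hS', hP, hB, hd'⟩ := h
  refine ⟨fromBlocks 1 0 0 S, fromBlocks 1 0 0 S', Sum.elim (fun _ => d) d',
    Sum.elim (fun _ => l) μ, ?_, ?_, ?_, ?_, ?_⟩
  · simp [fromBlocks_multiply, hS]
  · simp [fromBlocks_multiply, hS']
  · simp only [fromBlocks_conjTranspose, fromBlocks_multiply]
    simp [hP]
  · rw [charpoly_fromBlocks_zero₂₁, hB]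
    simp [charpoly_diagonal]
  · rintro (i | i)
    · simpa using hd
    · simpa using hd' i

lemma good15_step {κ : Type} [Fintype κ] [DecidableEq κ]
    (ih : ∀ B P : Matrix κ κ ℂ, P.IsHermitian → (P * B + Bᴴ * P).PosDef → Good15 B P)
    (B P : Matrix (Unit ⊕ κ) (Unit ⊕ κ) ℂ) (hP : P.IsHermitian)
    (hW : (P * B + Bᴴ * P).PosDef) : Good15 B P := by
  wlog hB : ∃ l : ℂ, B *ᵥ (Pi.single (Sum.inl ()) 1) = l • Pi.single (Sum.inl ()) 1 generalizing B P
  · obtain ⟨l, hl⟩ := Module.End.exists_eigenvalue (toLin' B)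
    obtain ⟨v, hv⟩ := hl.exists_hasEigenvector
    have hv1 : B *ᵥ v = l • v := by simpa using hv.apply_eq_smul
    obtain ⟨E, hE⟩ := SeparatingDual.exists_continuousLinearEquiv_apply_eq (R := ℂ)
      (x := (Pi.single (Sum.inl ()) 1 : Unit ⊕ κ → ℂ)) (y := v) (by simp) hv.2
    let T := LinearMap.toMatrix' (E.toLinearEquiv : (Unit ⊕ κ → ℂ) →ₗ[ℂ] (Unit ⊕ κ → ℂ))
    let T' := LinearMap.toMatrix' (E.symm.toLinearEquiv : (Unit ⊕ κ → ℂ) →ₗ[ℂ] (Unit ⊕ κ → ℂ))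
    have h1 : T * T' = 1 := by
      rw [← LinearMap.toMatrix'_comp, ← LinearMap.toMatrix'_id]
      congr 1; ext1; simp
    have h2 : T' * T = 1 := mul_eq_one_comm.mp h1
    have hT : T *ᵥ (Pi.single (Sum.inl ()) 1) = v := by
      rw [← hE]; simp only [T, LinearMap.toMatrix'_mulVec]; rfl
    refine good15_conj h1 h2 (this _ _ ?_ (posDef15_conj h1 h2 hW) ⟨l, ?_⟩)
    · exact isHermitian_conjTranspose_mul_mul T hP
    · rw [← mulVec_mulVec, ← mulVec_mulVec, hT, hv1, mulVec_smul, ← hT, mulVec_mulVec, h2,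
        one_mulVec]
  obtain ⟨l, hl⟩ := hB
  obtain ⟨b, B', rfl⟩ : ∃ b B', B = fromBlocks (diagonal fun _ => l) b 0 B' := by
    refine ⟨B.toBlocks₁₂, B.toBlocks₂₂, ?_⟩
    conv_lhs => rw [← fromBlocks_toBlocks B]
    congr 1
    · ext i j
      simpa [toBlocks₁₁, diagonal] using congrFun hl (Sum.inl ())
    · ext i j
      simpa [toBlocks₂₁] using congrFun hl (Sum.inr i)
  obtain ⟨d, r, Q, rfl⟩ : ∃ (d : ℝ) (r : Matrix Unit κ ℂ) (Q : Matrix κ κ ℂ),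
      P = fromBlocks (diagonal fun _ => (d : ℂ)) r rᴴ Q := by
    refine ⟨(P (Sum.inl ()) (Sum.inl ())).re, P.toBlocks₁₂, P.toBlocks₂₂, ?_⟩
    conv_lhs => rw [← fromBlocks_toBlocks P]
    congr 1
    · ext i j
      have := hP.apply (Sum.inl ()) (Sum.inl ())
      simpa [toBlocks₁₁, diagonal] using (Complex.conj_eq_iff_re.mp this).symm
    · ext i j
      simpa [toBlocks₂₁, toBlocks₁₂] using (hP.apply _ _).symm
  have hdl : 0 < d * l.re := by
    have := hW.diag_pos (i := Sum.inl ())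
    simp [fromBlocks_multiply, fromBlocks_conjTranspose, Complex.lt_def] at this
    nlinarith [this.1]
  have hd0 : (d : ℂ) ≠ 0 := by
    rintro h
    have : d = 0 := by exact_mod_cast h
    simp [this] at hdl
  have h1 : (fromBlocks 1 (-(d : ℂ)⁻¹ • r) 0 1 : Matrix (Unit ⊕ κ) (Unit ⊕ κ) ℂ) *
      fromBlocks 1 ((d : ℂ)⁻¹ • r) 0 1 = 1 := by
    simp [fromBlocks_multiply]
  have h2 := mul_eq_one_comm.mp h1
  have hW' := posDef15_conj h1 h2 hW
  have hP' := isHermitian_conjTranspose_mul_mul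
    (fromBlocks 1 (-(d : ℂ)⁻¹ • r) 0 1 : Matrix (Unit ⊕ κ) (Unit ⊕ κ) ℂ) hP
  refine good15_conj h1 h2 ?_
  have eB : ∃ b' B'', (fromBlocks 1 ((d : ℂ)⁻¹ • r) 0 1 : Matrix (Unit ⊕ κ) (Unit ⊕ κ) ℂ) *
      fromBlocks (diagonal fun _ => l) b 0 B' * fromBlocks 1 (-(d : ℂ)⁻¹ • r) 0 1 =
      fromBlocks (diagonal fun _ => l) b' 0 B'' := by
    simp only [fromBlocks_multiply, Matrix.mul_zero, Matrix.zero_mul, Matrix.one_mul,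
      Matrix.mul_one, add_zero, zero_add]
    exact ⟨_, _, rfl⟩
  have eP : ∃ Q', (fromBlocks 1 (-(d : ℂ)⁻¹ • r) 0 1 : Matrix (Unit ⊕ κ) (Unit ⊕ κ) ℂ)ᴴ *
      fromBlocks (diagonal fun _ => (d : ℂ)) r rᴴ Q * fromBlocks 1 (-(d : ℂ)⁻¹ • r) 0 1 =
      fromBlocks (diagonal fun _ => (d : ℂ)) 0 0 Q' := by
    have hdd : (diagonal fun _ : Unit => (d : ℂ)) = (d : ℂ) • (1 : Matrix Unit Unit ℂ) := by
      ext i j; simp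
    simp only [fromBlocks_conjTranspose, fromBlocks_multiply, hdd, fromBlocks_inj]
    refine ⟨_, ?_, ?_, ?_, rfl⟩
    · simp
    · simp
      ext i j
      simp
      field_simp
      simp
    · simp
      ext i j
      simp
      field_simp
      simp
  obtain ⟨b', B'', eB⟩ := eB
  obtain ⟨Q', eP⟩ := eP
  rw [eB, eP] at hW'
  rw [eP] at hP'
  rw [eB, eP]
  refine good15_block b' d l hdl (ih _ _ ?_ ?_)
  · exact hP'.submatrix Sum.inr
  · have := hW'.submatrix (e := Sum.inr) Sum.inr_injective
    convert this using 1
    ext i j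
    simp [fromBlocks_multiply, fromBlocks_conjTranspose]

lemma good15_reindex {ι κ : Type} [Fintype ι] [DecidableEq ι] [Fintype κ] [DecidableEq κ]
    (e : ι ≃ κ)
    (ih : ∀ B P : Matrix κ κ ℂ, P.IsHermitian → (P * B + Bᴴ * P).PosDef → Good15 B P)
    (B P : Matrix ι ι ℂ) (hP : P.IsHermitian)
    (hW : (P * B + Bᴴ * P).PosDef) : Good15 B P := by
  obtain ⟨S, S', d, μ, hS, hS', hP, hB, hd⟩ := ih (B.submatrix e.symm e.symm)
    (P.submatrix e.symm e.symm) (hP.submatrix _) (by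
      have := hW.submatrix e.symm.injective
      simpa [submatrix_mul_equiv, submatrix_add] using this)
  refine ⟨S.submatrix e e, S'.submatrix e e, d ∘ e, μ ∘ e, ?_, ?_, ?_, ?_, fun i => hd _⟩
  · simp [submatrix_mul_equiv, hS]
  · simp [submatrix_mul_equiv, hS']
  · have := congrArg (fun M => M.submatrix e e) hP
    simp only [submatrix_diagonal_equiv] at this
    rw [show (fun i => (((d ∘ e) i : ℝ) : ℂ)) = (fun i => (d i : ℂ)) ∘ e from rfl, ← this]
    rw [← submatrix_mul_equiv (e₂ := e), ← submatrix_mul_equiv (e₂ := e)]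
    simp
  · have := charpoly_reindex e B
    rw [← this, reindex_apply, hB]
    exact (Equiv.prod_comp e (fun i => Polynomial.X - Polynomial.C (μ i))).symm

lemma good15_all (n : ℕ) : ∀ B P : Matrix (Fin n) (Fin n) ℂ, P.IsHermitian →
    (P * B + Bᴴ * P).PosDef → Good15 B P := by
  induction n with
  | zero =>
    intro B P _ _
    exact ⟨1, 1, fun _ => 0, fun _ => 0, by simp, by simp, Subsingleton.elim _ _, by
      simp [charpoly, det_isEmpty], fun i => i.elim0⟩
  | succ n ih =>
    exact good15_reindex
      (((finCongr (add_comm n 1)).trans finSumFinEquiv.symm).trans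
        (Equiv.sumCongr (Equiv.equivPUnit (Fin 1)) (Equiv.refl _)) : Fin (n+1) ≃ Unit ⊕ Fin n)
      (good15_step ih)

/-- Half of the law of inertia. -/
lemma sylvester15 {n : ℕ} (S : Matrix (Fin n) (Fin n) ℂ) (d e : Fin n → ℝ)
    (h : Sᴴ * diagonal (fun i => (e i : ℂ)) * S = diagonal (fun i => (d i : ℂ))) :
    Fintype.card {i // 0 < d i} ≤ Fintype.card {i // 0 < e i} := by
  classical
  let R : Matrix (Fin n) {i // 0 < d i} ℂ := S.submatrix id Subtype.val
  have hR : Rᴴ * diagonal (fun i => (e i : ℂ)) * R = diagonal (fun i => (d i.1 : ℂ)) := by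
    ext i j
    have := congrFun (congrFun h i.1) j.1
    simpa [Matrix.mul_apply, diagonal_apply, R, Subtype.ext_iff] using this
  have key : ∀ x : {i // 0 < d i} → ℂ,
      ∑ j, e j * Complex.normSq ((R *ᵥ x) j) = ∑ i, d i.1 * Complex.normSq (x i) := by
    intro x
    have h1 := congrArg (fun M => star x ⬝ᵥ (M *ᵥ x)) hR
    simp only [← mulVec_mulVec] at h1
    rw [dotProduct_mulVec, ← star_mulVec] at h1
    simp only [dotProduct, mulVec_diagonal, Pi.star_apply] at h1
    have h2 : ∀ (a : ℝ) (z : ℂ), star z * ((a : ℂ) * z) = ((a * Complex.normSq z : ℝ) : ℂ) := by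
      intro a z
      push_cast
      rw [Complex.normSq_eq_conj_mul_self]
      simp only [Complex.star_def]
      ring
    simp only [h2] at h1
    exact_mod_cast h1
  let L : ({i // 0 < d i} → ℂ) →ₗ[ℂ] ({i // 0 < e i} → ℂ) :=
    (LinearMap.funLeft ℂ ℂ (Subtype.val : {i // 0 < e i} → Fin n)).comp R.mulVecLin
  refine card_le_of_injective ℂ L ?_
  rw [injective_iff_map_eq_zero]
  intro x hx
  have h0 : ∑ j, e j * Complex.normSq ((R *ᵥ x) j) ≤ 0 := by
    refine Finset.sum_nonpos fun j _ => ?_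
    by_cases hj : 0 < e j
    · have : (R *ᵥ x) j = 0 := congrFun hx ⟨j, hj⟩
      simp [this]
    · exact mul_nonpos_of_nonpos_of_nonneg (not_lt.mp hj) (Complex.normSq_nonneg _)
  rw [key] at h0
  have hnn : ∀ i ∈ Finset.univ, 0 ≤ d (i : {i // 0 < d i}).1 * Complex.normSq (x i) :=
    fun i _ => mul_nonneg i.2.le (Complex.normSq_nonneg _)
  have h3 := (Finset.sum_eq_zero_iff_of_nonneg hnn).mp (le_antisymm h0 (Finset.sum_nonneg hnn))
  ext i
  have := h3 i (Finset.mem_univ _)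
  rcases mul_eq_zero.mp this with h4 | h4
  · exact absurd h4 i.2.ne'
  · exact Complex.normSq_eq_zero.mp h4

lemma sylvester15_neg {n : ℕ} (S : Matrix (Fin n) (Fin n) ℂ) (d e : Fin n → ℝ)
    (h : Sᴴ * diagonal (fun i => (e i : ℂ)) * S = diagonal (fun i => (d i : ℂ))) :
    Fintype.card {i // d i < 0} ≤ Fintype.card {i // e i < 0} := by
  have := sylvester15 S (fun i => - d i) (fun i => - e i) (by
    have h1 : ∀ f : Fin n → ℝ, diagonal (fun i => ((-f i : ℝ) : ℂ)) =
        - diagonal (fun i => (f i : ℂ)) := by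
      intro f; ext i j; by_cases hij : i = j <;> simp [hij]
    rw [h1, h1, ← h, Matrix.mul_neg, Matrix.neg_mul])
  simpa using this

lemma roots15 {n : ℕ} (A : Matrix (Fin n) (Fin n) ℂ) (μ : Fin n → ℂ)
    (h : Aᴴ.charpoly = ∏ i, (Polynomial.X - Polynomial.C (μ i))) :
    A.charpoly.roots = (Finset.univ.val.map fun i => star (μ i)) := by
  have h1 : A = (Aᴴ.map (starRingEnd ℂ))ᵀ := by ext i j; simp
  rw [h1, charpoly_transpose, charpoly_map, h, Polynomial.map_prod]
  simp only [Polynomial.map_sub, Polynomial.map_X, Polynomial.map_C]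
  rw [← Polynomial.roots_multiset_prod_X_sub_C (Finset.univ.val.map fun i => star (μ i)),
    Multiset.map_map]
  rfl

theorem stmt_15 (n : ℕ) (A P W : Matrix (Fin n) (Fin n) ℂ)
    (hP : P.IsHermitian) (hW : W.PosDef) (hLyap : A * P + P * Aᴴ = W) :
    IsUnit P.det ∧
    Fintype.card {i : Fin n // 0 < hP.eigenvalues i}
      = Multiset.card (A.charpoly.roots.filter (fun z => 0 < z.re)) ∧
    Fintype.card {i : Fin n // hP.eigenvalues i < 0}
      = Multiset.card (A.charpoly.roots.filter (fun z => z.re < 0)) := by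
  obtain ⟨S, S', d, μ, hS, hS', hD, hB, hd⟩ := good15_all n Aᴴ P hP (by
    rw [conjTranspose_conjTranspose, add_comm, hLyap]; exact hW)
  have hr := roots15 A μ hB
  have hd0 : ∀ i, d i ≠ 0 := fun i h => by have := hd i; simp [h] at this
  let U : Matrix (Fin n) (Fin n) ℂ := hP.eigenvectorUnitary
  have hU1 : Uᴴ * U = 1 := Unitary.coe_star_mul_self hP.eigenvectorUnitary
  have hU2 : U * Uᴴ = 1 := Unitary.coe_mul_star_self hP.eigenvectorUnitary
  have hsp : P = U * diagonal (fun i => (hP.eigenvalues i : ℂ)) * Uᴴ := by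
    have := hP.spectral_theorem
    rw [Unitary.conjStarAlgAut_apply] at this
    exact this
  have e1 : (Uᴴ * S)ᴴ * diagonal (fun i => (hP.eigenvalues i : ℂ)) * (Uᴴ * S) =
      diagonal (fun i => (d i : ℂ)) := by
    rw [← hD]
    conv_rhs => rw [hsp]
    simp only [conjTranspose_mul, conjTranspose_conjTranspose, Matrix.mul_assoc]
  have e2 : (S' * U)ᴴ * diagonal (fun i => (d i : ℂ)) * (S' * U) =
      diagonal (fun i => (hP.eigenvalues i : ℂ)) := by
    have h3 : S'ᴴ * Sᴴ = 1 := by rw [← conjTranspose_mul, hS, conjTranspose_one]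
    calc (S' * U)ᴴ * diagonal (fun i => (d i : ℂ)) * (S' * U)
        = Uᴴ * (S'ᴴ * Sᴴ) * P * (S * S') * U := by
          rw [← hD]; simp only [conjTranspose_mul, Matrix.mul_assoc]
      _ = Uᴴ * P * U := by rw [h3, hS, Matrix.mul_one, Matrix.mul_one]
      _ = (Uᴴ * U) * diagonal (fun i => (hP.eigenvalues i : ℂ)) * (Uᴴ * U) := by
          conv_lhs => rw [hsp]
          simp only [Matrix.mul_assoc]
      _ = _ := by rw [hU1, Matrix.mul_one, Matrix.one_mul]
  refine ⟨?_, ?_, ?_⟩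
  · rw [isUnit_iff_ne_zero]
    intro h0
    have := congrArg det hD
    rw [det_mul, det_mul, h0, det_diagonal] at this
    simp only [mul_zero, zero_mul] at this
    obtain ⟨i, -, hi⟩ := Finset.prod_eq_zero_iff.mp this.symm
    exact hd0 i (by exact_mod_cast hi)
  · rw [le_antisymm (sylvester15 _ _ _ e2) (sylvester15 _ _ _ e1), hr, Multiset.filter_map,
      Multiset.card_map, Fintype.card_subtype]
    change _ = (Finset.univ.filter _).card
    congr 1
    ext i
    have := hd i
    simp only [Finset.mem_filter, Finset.mem_univ, true_and, Function.comp, Complex.star_def,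
      Complex.conj_re]
    constructor
    · intro h; by_contra h'; nlinarith [not_lt.mp h']
    · intro h; by_contra h'; nlinarith [not_lt.mp h']
  · rw [le_antisymm (sylvester15_neg _ _ _ e2) (sylvester15_neg _ _ _ e1), hr, Multiset.filter_map,
      Multiset.card_map, Fintype.card_subtype]
    change _ = (Finset.univ.filter _).card
    congr 1
    ext i
    have := hd i
    simp only [Finset.mem_filter, Finset.mem_univ, true_and, Function.comp, Complex.star_def,
      Complex.conj_re]
    constructor
    · intro h; by_contra h'; nlinarith [not_lt.mp h']
    · intro h; by_contra h'; nlinarith [not_lt.mp h']
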